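/- For every integer n > 74, one has (n - π(n)) · log(p_{n+1}) > p_{n+1} · log 2. -/

import Mathlib

/-- The number 230!, written out. -/
def bigQ : ℕ := 7758587304686725201813174298892781442413952130995533365303964524344944412641389739603152000644515957408814002319492032321234250506968028455594445689972313374305301019340949789291189972149450405025159624155827152329676580440959428615802893638146558163235483142136540783687811997927615346859658417205832954125915861983307177232587595821512723429698627780530255874167602077755356592824804966400000000000000000000000000000000000000000000000000000000

theorem bigQ_eq : bigQ = Nat.factorial 230 := by decide +kernel

theorem prime_iff_coprime (m : ℕ) (h1 : 230 < m) (h2 : m < 231 * 231) :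
    Nat.Prime m ↔ Nat.gcd m bigQ = 1 := by
  rw [bigQ_eq]
  constructor
  · intro hp
    exact hp.coprime_factorial_of_lt h1
  · intro hc
    by_contra hnp
    have hsq := Nat.minFac_sq_le_self (by omega : 0 < m) hnp
    have hle : m.minFac ≤ 230 := by
      by_contra hlt
      push Not at hlt
      nlinarith
    have hd : m.minFac ∣ Nat.factorial 230 := Nat.dvd_factorial (Nat.minFac_pos m) hle
    have := Nat.dvd_gcd (Nat.minFac_dvd m) hd
    rw [hc] at this
    have h3 := Nat.dvd_one.mp this
    rw [Nat.minFac_eq_one_iff] at h3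
    omega

/-- Number of integers in [lo, lo + w) which are coprime to 230!, by binary splitting. -/
def cnt (fuel : ℕ) : ℕ → ℕ → ℕ :=
  Nat.rec
    (fun lo w => bif Nat.beq w 0 then 0 else (bif Nat.beq (Nat.gcd lo bigQ) 1 then 1 else 0))
    (fun _ f lo w => Nat.add (f lo (Nat.div w 2))
      (f (Nat.add lo (Nat.div w 2)) (Nat.sub w (Nat.div w 2)))) fuel

theorem cnt_zero (lo w : ℕ) : cnt 0 lo w =
    bif Nat.beq w 0 then 0 else (bif Nat.beq (Nat.gcd lo bigQ) 1 then 1 else 0) := rfl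

theorem cnt_succ (fuel lo w : ℕ) : cnt (fuel + 1) lo w =
    cnt fuel lo (w / 2) + cnt fuel (lo + w / 2) (w - w / 2) := rfl

theorem cnt_spec (fuel : ℕ) : ∀ lo w : ℕ, 230 < lo → lo + w ≤ 231 * 231 → w ≤ 2 ^ fuel →
    Nat.primeCounting' (lo + w) = Nat.primeCounting' lo + cnt fuel lo w := by
  induction fuel with
  | zero =>
    intro lo w h1 h2 h3
    rcases Nat.eq_zero_or_pos w with rfl | hw
    · simp [cnt_zero]
    · have : w = 1 := by simp at h3; omega
      subst this
      have hp := prime_iff_coprime lo h1 (by omega)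
      by_cases hg : Nat.gcd lo bigQ = 1
      · have hb : Nat.beq 1 0 = false := rfl
        simp [cnt_zero, Nat.primeCounting', Nat.count_succ, hp, hg, hb]
      · have hb : Nat.beq (Nat.gcd lo bigQ) 1 = false := by
          rw [← Bool.not_eq_true, Nat.beq_eq]; exact hg
        simp [cnt_zero, Nat.primeCounting', Nat.count_succ, hp, hg, hb]
  | succ k ih =>
    intro lo w h1 h2 h3
    rw [pow_succ] at h3
    have e1 := ih lo (w / 2) h1 (by omega) (by omega)
    have e2 := ih (lo + w / 2) (w - w / 2) (by omega) (by omega) (by omega)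
    have e3 : lo + w / 2 + (w - w / 2) = lo + w := by omega
    rw [e3] at e2
    rw [e2, e1, cnt_succ, add_assoc]

theorem cnt_step {fuel : ℕ} (lo w c d : ℕ) (h1 : 230 < lo) (h2 : lo + w ≤ 231 * 231)
    (h3 : w ≤ 2 ^ fuel) (h4 : Nat.primeCounting' lo = c) (h5 : c + cnt fuel lo w = d) :
    Nat.primeCounting' (lo + w) = d := by
  rw [cnt_spec fuel lo w h1 h2 h3, h4, h5]

theorem cp_76 : Nat.primeCounting' 76 = 21 := by decide +kernel

theorem cp_93 : Nat.primeCounting' 93 = 24 := by decide +kernel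

theorem cp_116 : Nat.primeCounting' 116 = 30 := by decide +kernel

theorem cp_144 : Nat.primeCounting' 144 = 34 := by decide +kernel

theorem cp_185 : Nat.primeCounting' 185 = 42 := by decide +kernel

theorem cp_239 : Nat.primeCounting' 239 = 51 := by decide +kernel

theorem cp_311 : Nat.primeCounting' 311 = 63 :=
  cnt_step (fuel := 14) 239 72 51 63 (by norm_num) (by norm_num) (by norm_num) cp_239 (by decide +kernel)

theorem cp_411 : Nat.primeCounting' 411 = 80 :=
  cnt_step (fuel := 14) 311 100 63 80 (by norm_num) (by norm_num) (by norm_num) cp_311 (by decide +kernel)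

theorem cp_480 : Nat.primeCounting' 480 = 92 :=
  cnt_step (fuel := 14) 411 69 80 92 (by norm_num) (by norm_num) (by norm_num) cp_411 (by decide +kernel)

theorem cp_547 : Nat.primeCounting' 547 = 100 :=
  cnt_step (fuel := 14) 480 67 92 100 (by norm_num) (by norm_num) (by norm_num) cp_480 (by decide +kernel)

theorem cp_632 : Nat.primeCounting' 632 = 115 :=
  cnt_step (fuel := 14) 547 85 100 115 (by norm_num) (by norm_num) (by norm_num) cp_547 (by decide +kernel)

theorem cp_733 : Nat.primeCounting' 733 = 129 :=
  cnt_step (fuel := 14) 632 101 115 129 (by norm_num) (by norm_num) (by norm_num) cp_632 (by decide +kernel)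

theorem cp_824 : Nat.primeCounting' 824 = 143 :=
  cnt_step (fuel := 14) 733 91 129 143 (by norm_num) (by norm_num) (by norm_num) cp_733 (by decide +kernel)

theorem cp_988 : Nat.primeCounting' 988 = 166 :=
  cnt_step (fuel := 14) 824 164 143 166 (by norm_num) (by norm_num) (by norm_num) cp_824 (by decide +kernel)

theorem cp_1098 : Nat.primeCounting' 1098 = 184 :=
  cnt_step (fuel := 14) 988 110 166 184 (by norm_num) (by norm_num) (by norm_num) cp_988 (by decide +kernel)

theorem cp_1337 : Nat.primeCounting' 1337 = 217 :=
  cnt_step (fuel := 14) 1098 239 184 217 (by norm_num) (by norm_num) (by norm_num) cp_1098 (by decide +kernel)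

theorem cp_1494 : Nat.primeCounting' 1494 = 238 :=
  cnt_step (fuel := 14) 1337 157 217 238 (by norm_num) (by norm_num) (by norm_num) cp_1337 (by decide +kernel)

theorem cp_1819 : Nat.primeCounting' 1819 = 280 :=
  cnt_step (fuel := 14) 1494 325 238 280 (by norm_num) (by norm_num) (by norm_num) cp_1494 (by decide +kernel)

theorem cp_2054 : Nat.primeCounting' 2054 = 310 :=
  cnt_step (fuel := 14) 1819 235 280 310 (by norm_num) (by norm_num) (by norm_num) cp_1819 (by decide +kernel)

theorem cp_2490 : Nat.primeCounting' 2490 = 367 :=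
  cnt_step (fuel := 14) 2054 436 310 367 (by norm_num) (by norm_num) (by norm_num) cp_2054 (by decide +kernel)

theorem cp_2820 : Nat.primeCounting' 2820 = 410 :=
  cnt_step (fuel := 14) 2490 330 367 410 (by norm_num) (by norm_num) (by norm_num) cp_2490 (by decide +kernel)

theorem cp_3413 : Nat.primeCounting' 3413 = 479 :=
  cnt_step (fuel := 14) 2820 593 410 479 (by norm_num) (by norm_num) (by norm_num) cp_2820 (by decide +kernel)

theorem cp_3932 : Nat.primeCounting' 3932 = 546 :=
  cnt_step (fuel := 14) 3413 519 479 546 (by norm_num) (by norm_num) (by norm_num) cp_3413 (by decide +kernel)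

theorem cp_4708 : Nat.primeCounting' 4708 = 635 :=
  cnt_step (fuel := 14) 3932 776 546 635 (by norm_num) (by norm_num) (by norm_num) cp_3932 (by decide +kernel)

theorem cp_5532 : Nat.primeCounting' 5532 = 732 :=
  cnt_step (fuel := 14) 4708 824 635 732 (by norm_num) (by norm_num) (by norm_num) cp_4708 (by decide +kernel)

theorem cp_7794 : Nat.primeCounting' 7794 = 987 :=
  cnt_step (fuel := 14) 5532 2262 732 987 (by norm_num) (by norm_num) (by norm_num) cp_5532 (by decide +kernel)

theorem cp_11004 : Nat.primeCounting' 11004 = 1336 :=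
  cnt_step (fuel := 14) 7794 3210 987 1336 (by norm_num) (by norm_num) (by norm_num) cp_7794 (by decide +kernel)

theorem cp_15584 : Nat.primeCounting' 15584 = 1818 :=
  cnt_step (fuel := 14) 11004 4580 1336 1818 (by norm_num) (by norm_num) (by norm_num) cp_11004 (by decide +kernel)

theorem cp_22194 : Nat.primeCounting' 22194 = 2489 :=
  cnt_step (fuel := 14) 15584 6610 1818 2489 (by norm_num) (by norm_num) (by norm_num) cp_15584 (by decide +kernel)

theorem cp_31728 : Nat.primeCounting' 31728 = 3412 :=
  cnt_step (fuel := 14) 22194 9534 2489 3412 (by norm_num) (by norm_num) (by norm_num) cp_22194 (by decide +kernel)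

theorem cp_45362 : Nat.primeCounting' 45362 = 4707 :=
  cnt_step (fuel := 14) 31728 13634 3412 4707 (by norm_num) (by norm_num) (by norm_num) cp_31728 (by decide +kernel)

theorem cp_48612 : Nat.primeCounting' 48612 = 5000 :=
  cnt_step (fuel := 14) 45362 3250 4707 5000 (by norm_num) (by norm_num) (by norm_num) cp_45362 (by decide +kernel)

theorem block (a b k P c n : ℕ) (ha : a ≤ n) (hb : n < b)
    (h1 : Nat.primeCounting' (a + 1) = c) (h2 : Nat.primeCounting' (P + 1) = b)
    (hk : k + c = a) (hk0 : 75 ≤ a) (h3 : 2 ^ P < P ^ k) :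
    (Nat.nth Nat.Prime n : ℝ) * Real.log 2 <
      ((n : ℝ) - n.primeCounting) * Real.log (Nat.nth Nat.Prime n) := by
  set p := Nat.nth Nat.Prime n with hp
  have hp3 : 3 ≤ p := by
    have := Nat.add_two_le_nth_prime n
    omega
  have hpP : p ≤ P := by
    have : p < P + 1 := Nat.nth_lt_of_lt_count (by
      change n < Nat.primeCounting' (P + 1); omega)
    omega
  -- monotonicity of `n - π n`
  have hmono : Nat.primeCounting n ≤ c + (n - a) := by
    have : Nat.count Nat.Prime (a + 1 + (n - a)) ≤ Nat.count Nat.Prime (a + 1) + (n - a) := by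
      rw [Nat.count_add]
      gcongr
      exact Nat.count_le _
    have e : a + 1 + (n - a) = n + 1 := by omega
    rw [e] at this
    change Nat.primeCounting' (n + 1) ≤ _
    have h1' : Nat.count Nat.Prime (a + 1) = c := h1
    rw [h1'] at this
    exact this
  have hkn : (k : ℝ) ≤ (n : ℝ) - n.primeCounting := by
    have : k + Nat.primeCounting n ≤ n := by omega
    have : ((k + Nat.primeCounting n : ℕ) : ℝ) ≤ n := by exact_mod_cast this
    push_cast at this
    linarith
  have hp3' : (3 : ℝ) ≤ p := by exact_mod_cast hp3
  have hpP' : (p : ℝ) ≤ P := by exact_mod_cast hpP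
  have hlog : (P : ℝ) * Real.log 2 < k * Real.log P := by
    have hh : ((2 : ℝ)) ^ P < (P : ℝ) ^ k := by exact_mod_cast h3
    have := Real.log_lt_log (by positivity) hh
    rwa [Real.log_pow, Real.log_pow] at this
  have hlogp : 0 < Real.log p := Real.log_pos (by linarith)
  have hlogP : 0 < Real.log P := Real.log_pos (by linarith)
  have hexp : Real.exp 1 ≤ 3 := by linarith [Real.exp_one_lt_d9]
  have hanti := Real.log_div_self_antitoneOn (show (p : ℝ) ∈ {x | Real.exp 1 ≤ x} by
    simp only [Set.mem_ofPred_eq]; linarith) (show (P : ℝ) ∈ {x | Real.exp 1 ≤ x} by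
    simp only [Set.mem_ofPred_eq]; linarith) hpP'
  have hP0 : (0 : ℝ) < P := by linarith
  have hp0 : (0 : ℝ) < p := by linarith
  have h5 : Real.log 2 < k * (Real.log P / P) := by
    rw [← mul_div_assoc, lt_div_iff₀ hP0]; linarith
  have h6 : Real.log 2 < k * (Real.log p / p) :=
    h5.trans_le (mul_le_mul_of_nonneg_left hanti (by positivity))
  rw [← mul_div_assoc, lt_div_iff₀ hp0] at h6
  have h7 := mul_le_mul_of_nonneg_right hkn hlogp.le
  linarith

theorem finite_range (n : ℕ) (h1 : 75 ≤ n) (h2 : n < 5000) :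
    (Nat.nth Nat.Prime n : ℝ) * Real.log 2 < ((n : ℝ) - n.primeCounting) * Real.log (Nat.nth Nat.Prime n) := by
  rcases lt_or_ge n 92 with h | h
  · exact block 75 92 54 479 21 n (by omega) h cp_76 cp_480 (by norm_num) (by norm_num) (by decide +kernel)
  rcases lt_or_ge n 115 with h | h
  · exact block 92 115 68 631 24 n (by omega) h cp_93 cp_632 (by norm_num) (by norm_num) (by decide +kernel)
  rcases lt_or_ge n 143 with h | h
  · exact block 115 143 85 823 30 n (by omega) h cp_116 cp_824 (by norm_num) (by norm_num) (by decide +kernel)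
  rcases lt_or_ge n 184 with h | h
  · exact block 143 184 109 1097 34 n (by omega) h cp_144 cp_1098 (by norm_num) (by norm_num) (by decide +kernel)
  rcases lt_or_ge n 238 with h | h
  · exact block 184 238 142 1493 42 n (by omega) h cp_185 cp_1494 (by norm_num) (by norm_num) (by decide +kernel)
  rcases lt_or_ge n 310 with h | h
  · exact block 238 310 187 2053 51 n (by omega) h cp_239 cp_2054 (by norm_num) (by norm_num) (by decide +kernel)
  rcases lt_or_ge n 410 with h | h
  · exact block 310 410 247 2819 63 n (by omega) h cp_311 cp_2820 (by norm_num) (by norm_num) (by decide +kernel)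
  rcases lt_or_ge n 546 with h | h
  · exact block 410 546 330 3931 80 n (by omega) h cp_411 cp_3932 (by norm_num) (by norm_num) (by decide +kernel)
  rcases lt_or_ge n 732 with h | h
  · exact block 546 732 446 5531 100 n (by omega) h cp_547 cp_5532 (by norm_num) (by norm_num) (by decide +kernel)
  rcases lt_or_ge n 987 with h | h
  · exact block 732 987 603 7793 129 n (by omega) h cp_733 cp_7794 (by norm_num) (by norm_num) (by decide +kernel)
  rcases lt_or_ge n 1336 with h | h
  · exact block 987 1336 821 11003 166 n (by omega) h cp_988 cp_11004 (by norm_num) (by norm_num) (by decide +kernel)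
  rcases lt_or_ge n 1818 with h | h
  · exact block 1336 1818 1119 15583 217 n (by omega) h cp_1337 cp_15584 (by norm_num) (by norm_num) (by decide +kernel)
  rcases lt_or_ge n 2489 with h | h
  · exact block 1818 2489 1538 22193 280 n (by omega) h cp_1819 cp_22194 (by norm_num) (by norm_num) (by decide +kernel)
  rcases lt_or_ge n 3412 with h | h
  · exact block 2489 3412 2122 31727 367 n (by omega) h cp_2490 cp_31728 (by norm_num) (by norm_num) (by decide +kernel)
  rcases lt_or_ge n 4707 with h | h
  · exact block 3412 4707 2933 45361 479 n (by omega) h cp_3413 cp_45362 (by norm_num) (by norm_num) (by decide +kernel)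
  rcases lt_or_ge n 5000 with h | h
  · exact block 4707 5000 4072 48611 635 n (by omega) h cp_4708 cp_48612 (by norm_num) (by norm_num) (by decide +kernel)
  omega
open ArithmeticFunction in
theorem log_factorial_eq (N M : ℕ) (hM : N ≤ M) :
    Real.log (Nat.factorial N) = ∑ m ∈ Finset.Ioc 0 M, vonMangoldt m * ((N / m : ℕ) : ℝ) := by
  have h1 := sum_Ioc_mul_zeta_eq_sum vonMangoldt N
  rw [vonMangoldt_mul_zeta] at h1
  have h2 : Real.log (Nat.factorial N) = ∑ n ∈ Finset.Ioc 0 N, ArithmeticFunction.log n := by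
    clear h1 hM
    induction N with
    | zero => simp
    | succ k ih =>
      rw [Finset.sum_Ioc_succ_top (Nat.zero_le k), ← ih, Nat.factorial_succ]
      push_cast
      rw [Real.log_mul (by positivity) (by positivity), ArithmeticFunction.log_apply]
      push_cast
      ring
  rw [h2, h1]
  apply Finset.sum_subset
  · exact Finset.Ioc_subset_Ioc_right hM
  · intro x hx hx'
    simp only [Finset.mem_Ioc] at hx hx'
    rw [Nat.div_eq_of_lt (by omega)]
    simp

open ArithmeticFunction in
theorem cheb_psi_lower (N : ℕ) :
    Real.log (Nat.factorial N) + Real.log (Nat.factorial (N / 30))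
      - Real.log (Nat.factorial (N / 2)) - Real.log (Nat.factorial (N / 3))
      - Real.log (Nat.factorial (N / 5)) ≤ Chebyshev.psi N := by
  rw [log_factorial_eq N N le_rfl, log_factorial_eq (N / 30) N (Nat.div_le_self _ _),
    log_factorial_eq (N / 2) N (Nat.div_le_self _ _),
    log_factorial_eq (N / 3) N (Nat.div_le_self _ _),
    log_factorial_eq (N / 5) N (Nat.div_le_self _ _), ← Finset.sum_add_distrib,
    ← Finset.sum_sub_distrib, ← Finset.sum_sub_distrib, ← Finset.sum_sub_distrib,
    Chebyshev.psi, Nat.floor_natCast]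
  apply Finset.sum_le_sum
  intro m _
  have hL : (0 : ℝ) ≤ vonMangoldt m := vonMangoldt_nonneg
  have e (d : ℕ) : N / d / m = N / m / d := by
    rw [Nat.div_div_eq_div_mul, Nat.div_div_eq_div_mul, mul_comm]
  rw [e, e, e, e]
  generalize N / m = k
  have hk : k + k / 30 ≤ 1 + k / 2 + k / 3 + k / 5 := by omega
  have hk' : ((k + k / 30 : ℕ) : ℝ) ≤ ((1 + k / 2 + k / 3 + k / 5 : ℕ) : ℝ) := by
    exact_mod_cast hk
  rw [Nat.cast_add, Nat.cast_add, Nat.cast_add, Nat.cast_add, Nat.cast_one] at hk'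
  have := mul_le_mul_of_nonneg_left hk' hL
  nlinarith

theorem log_fac_lower (n : ℕ) : (n : ℝ) * Real.log n - n ≤ Real.log (Nat.factorial n) := by
  rcases Nat.eq_zero_or_pos n with rfl | hn
  · simp
  · have h := Stirling.le_log_factorial_stirling hn.ne'
    have h1 : 0 ≤ Real.log n := Real.log_natCast_nonneg n
    have h2 : 0 ≤ Real.log (2 * Real.pi) := Real.log_nonneg (by nlinarith [Real.pi_gt_three])
    linarith

/-- `x log x - x` is monotone on `[1, ∞)`. -/
theorem xlogx_mono {x y : ℝ} (hx : 1 ≤ x) (hxy : x ≤ y) :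
    x * Real.log x - x ≤ y * Real.log y - y := by
  have hx0 : 0 < x := by linarith
  have hy0 : 0 < y := by linarith
  have h1 := Real.log_le_sub_one_of_pos (show 0 < x / y by positivity)
  rw [Real.log_div hx0.ne' hy0.ne'] at h1
  have h2 : y * (Real.log x - Real.log y) ≤ y * (x / y - 1) :=
    mul_le_mul_of_nonneg_left h1 hy0.le
  have h3 : y * (x / y - 1) = x - y := by field_simp
  have h4 : 0 ≤ (y - x) * Real.log x := mul_nonneg (by linarith) (Real.log_nonneg hx)
  nlinarith

theorem log_fac_upper (n : ℕ) (hn : 1 ≤ n) :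
    Real.log (Nat.factorial n) ≤ (n : ℝ) * Real.log n - n + 1 + Real.log n := by
  induction n, hn using Nat.le_induction with
  | base => simp
  | succ k hk ih =>
    have hk0 : (0 : ℝ) < k := by exact_mod_cast hk
    rw [Nat.factorial_succ]
    push_cast
    rw [Real.log_mul (by positivity) (by positivity)]
    have h1 := Real.log_le_sub_one_of_pos (show 0 < (k : ℝ) / (k + 1) by positivity)
    rw [Real.log_div (by positivity) (by positivity)] at h1
    have h2 : ((k : ℝ) + 1) * (Real.log k - Real.log (k + 1)) ≤ (k + 1) * (k / (k + 1) - 1) :=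
      mul_le_mul_of_nonneg_left h1 (by positivity)
    have h3 : ((k : ℝ) + 1) * (k / (k + 1) - 1) = -1 := by field_simp; ring
    nlinarith

theorem fac_div_upper (N d : ℕ) (hd : 0 < d) (h : d ≤ N) :
    Real.log (Nat.factorial (N / d)) ≤
      (N / d : ℝ) * (Real.log N - Real.log d) - N / d + 1 + Real.log N := by
  have hN0 : (0 : ℝ) < N := by exact_mod_cast (by omega : 0 < N)
  have hd0 : (0 : ℝ) < d := by exact_mod_cast hd
  have h1 : 1 ≤ N / d := (Nat.one_le_div_iff hd).mpr h
  have h1' : (1 : ℝ) ≤ ((N / d : ℕ) : ℝ) := by exact_mod_cast h1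
  have h2 := log_fac_upper _ h1
  have h3 : ((N / d : ℕ) : ℝ) ≤ N / d := Nat.cast_div_le
  have h4 := xlogx_mono h1' h3
  rw [Real.log_div hN0.ne' hd0.ne'] at h4
  have h5 : Real.log ((N / d : ℕ) : ℝ) ≤ Real.log N :=
    Real.log_le_log (by linarith) (by exact_mod_cast Nat.div_le_self N d)
  linarith

theorem fac_div_lower (N d : ℕ) (hd : 1 < d) (h : d ≤ N) :
    (N / d : ℝ) * (Real.log N - Real.log d) - N / d - Real.log N ≤
      Real.log (Nat.factorial (N / d)) := by
  have hN0 : (0 : ℝ) < N := by exact_mod_cast (by omega : 0 < N)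
  have hd0 : (0 : ℝ) < d := by exact_mod_cast (by omega : 0 < d)
  have h1 : (1 : ℝ) ≤ N / d := by rw [le_div_iff₀ hd0]; simpa using (by exact_mod_cast h)
  have h3 : (N / d : ℝ) ≤ ((N / d + 1 : ℕ) : ℝ) := by
    rw [div_le_iff₀ hd0]
    have := Nat.lt_mul_div_succ N (by omega : 0 < d)
    have h' : N ≤ (N / d + 1) * d := by rw [mul_comm]; exact this.le
    exact_mod_cast h'
  have h4 := xlogx_mono h1 h3
  rw [Real.log_div hN0.ne' hd0.ne'] at h4
  have h2 := log_fac_lower (N / d + 1)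
  have e : Real.log (Nat.factorial (N / d + 1)) =
      Real.log ((N / d + 1 : ℕ) : ℝ) + Real.log (Nat.factorial (N / d)) := by
    rw [Nat.factorial_succ, Nat.cast_mul, Real.log_mul (by positivity) (by positivity)]
  have h5 : Real.log ((N / d + 1 : ℕ) : ℝ) ≤ Real.log N := by
    apply Real.log_le_log (by positivity)
    have : N / d < N := Nat.div_lt_self (by omega) hd
    exact_mod_cast this
  linarith

theorem psi_lower (N : ℕ) (h : 30 ≤ N) :
    (93 / 70 : ℝ) * Real.log 2 * N - 4 * Real.log N - 3 ≤ Chebyshev.psi N := by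
  have h0 := cheb_psi_lower N
  have h1 := log_fac_lower N
  have h30 := fac_div_lower N 30 (by norm_num) h
  have h2 := fac_div_upper N 2 (by norm_num) (by omega)
  have h3 := fac_div_upper N 3 (by norm_num) (by omega)
  have h5 := fac_div_upper N 5 (by norm_num) (by omega)
  push_cast at h30 h2 h3 h5
  have e30 : Real.log 30 = Real.log 2 + Real.log 3 + Real.log 5 := by
    rw [← Real.log_mul (by norm_num) (by norm_num), ← Real.log_mul (by norm_num) (by norm_num)]
    norm_num
  have l3 : 19 * Real.log 2 ≤ 12 * Real.log 3 := by
    have := Real.log_le_log (by norm_num) (show (2 : ℝ) ^ 19 ≤ 3 ^ 12 by norm_num)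
    rw [Real.log_pow, Real.log_pow] at this
    exact_mod_cast this
  have l5 : 65 * Real.log 2 ≤ 28 * Real.log 5 := by
    have := Real.log_le_log (by norm_num) (show (2 : ℝ) ^ 65 ≤ 5 ^ 28 by norm_num)
    rw [Real.log_pow, Real.log_pow] at this
    exact_mod_cast this
  rw [e30] at h30
  have hN : (0 : ℝ) ≤ N := by positivity
  have m3 := mul_le_mul_of_nonneg_right l3 hN
  have m5 := mul_le_mul_of_nonneg_right l5 hN
  ring_nf at *
  linarith

theorem pi_upper (n : ℕ) (h : 210 ≤ n) : (n.primeCounting : ℝ) ≤ 46 + 8 * n / 35 := by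
  have h1 := Nat.primeCounting'_add_le (a := 210) (k := 211) (by norm_num) (by norm_num) (n - 210)
  have e1 : Nat.primeCounting' 211 = 46 := by decide +kernel
  have e2 : Nat.totient 210 = 48 := by decide +kernel
  rw [e1, e2, show 211 + (n - 210) = n + 1 by omega] at h1
  change Nat.primeCounting n ≤ _ at h1
  have h2 : 35 * Nat.primeCounting n ≤ 35 * 46 + 8 * n := by omega
  have h3 : ((35 * Nat.primeCounting n : ℕ) : ℝ) ≤ ((35 * 46 + 8 * n : ℕ) : ℝ) := by
    exact_mod_cast h2
  push_cast at h3
  linarith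

theorem large_range (n : ℕ) (h : 5000 ≤ n) (hp : 48000 ≤ Nat.nth Nat.Prime n) :
    (Nat.nth Nat.Prime n : ℝ) * Real.log 2 <
      ((n : ℝ) - n.primeCounting) * Real.log (Nat.nth Nat.Prime n) := by
  have hprime := Nat.prime_nth_prime n
  have hcount := Nat.primeCounting'_nth_eq n
  set p := Nat.nth Nat.Prime n with hpdef
  have hpi : Nat.primeCounting p = n + 1 := by
    change Nat.count Nat.Prime (p + 1) = n + 1
    rw [Nat.count_succ, if_pos hprime]
    exact congrArg (· + 1) hcount
  have h1 := Chebyshev.psi_le_primeCounting_mul_log p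
  rw [hpi] at h1
  push_cast at h1
  have h2 := psi_lower p (by omega)
  have h3 := pi_upper n (by omega)
  have hp' : (48000 : ℝ) ≤ p := by exact_mod_cast hp
  have hL : 0 < Real.log p := Real.log_pos (by linarith)
  have hL2 : Real.log p ≤ p / 65536 - 1 + 16 * Real.log 2 := by
    have := Real.log_le_sub_one_of_pos (show 0 < (p : ℝ) / 2 ^ 16 by positivity)
    rw [Real.log_div (by positivity) (by positivity), Real.log_pow] at this
    norm_num at this ⊢
    linarith
  have hl2 := Real.log_two_lt_d9
  have hl2' := Real.log_two_gt_d9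
  have h4 : (27 / 35 * ((n : ℝ) + 1) - 47) * Real.log p ≤
      ((n : ℝ) - n.primeCounting) * Real.log p := by
    apply mul_le_mul_of_nonneg_right _ hL.le
    linarith
  have h6 : 0.69 * (p : ℝ) ≤ Real.log 2 * p := by
    apply mul_le_mul_of_nonneg_right _ (by linarith)
    linarith
  nlinarith

/-- For every integer `n > 74`, `(n - π n) * log p_{n+1} > p_{n+1} * log 2`,
where `p_{n+1} = Nat.nth Nat.Prime n`. -/
theorem stmt12 (n : ℕ) (hn : n > 74) :
    ((n : ℝ) - n.primeCounting) * Real.log (Nat.nth Nat.Prime n) >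
      (Nat.nth Nat.Prime n : ℝ) * Real.log 2 := by
  rcases lt_or_ge n 5000 with h | h
  · exact finite_range n hn h
  · refine large_range n h ?_
    by_contra hlt
    push Not at hlt
    have hm := Nat.monotone_primeCounting' (show Nat.nth Nat.Prime n ≤ 48612 by omega)
    rw [Nat.primeCounting'_nth_eq, cp_48612] at hm
    have hn5 : n = 5000 := le_antisymm hm h
    have hs : Nat.primeCounting' (Nat.nth Nat.Prime n + 1) = n + 1 := by
      change Nat.count Nat.Prime (Nat.nth Nat.Prime n + 1) = n + 1
      rw [Nat.count_succ, if_pos (Nat.prime_nth_prime n)]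
      exact congrArg (· + 1) (Nat.primeCounting'_nth_eq n)
    have hm2 := Nat.monotone_primeCounting' (show Nat.nth Nat.Prime n + 1 ≤ 48612 by omega)
    rw [hs, cp_48612] at hm2
    omega
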